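/- arXiv:2307.09645 — 3 statements merged into one kernel-verified Lean document; each statement's English description precedes it below -/
import Mathlib

section
/- Let M be the positive monoid generated by {1/p : p prime}. Then M is a length-finite factorization monoid (LFFM) but not a bounded factorization monoid (BFM): the set of atoms of M is exactly {1/p : p prime}, the set of factorizations of the element 1 consists precisely of the multisets containing the atom 1/p with multiplicity p for each prime p, and hence the set of lengths of factorizations of 1 is the (infinite) set of all primes. -/
/-- `a` is an (additive) atom of the set `M ⊆ ℝ`. -/
def IsAddAtom (M : Set ℝ) (a : ℝ) : Prop :=
  a ∈ M ∧ a ≠ 0 ∧ ∀ b ∈ M, ∀ c ∈ M, a = b + c → b = 0 ∨ c = 0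

/-- The factorizations of `x` in `M`: multisets of atoms of `M` summing to `x`. -/
def AddFactorizations (M : Set ℝ) (x : ℝ) : Set (Multiset ℝ) :=
  {s | (∀ a ∈ s, IsAddAtom M a) ∧ s.sum = x}

/-- `M` is atomic: every nonzero element has a factorization into atoms. -/
def IsAddAtomic (M : Set ℝ) : Prop :=
  ∀ x ∈ M, x ≠ 0 → (AddFactorizations M x).Nonempty

/-- `M` is a bounded factorization monoid. -/
def IsBFM (M : Set ℝ) : Prop :=
  IsAddAtomic M ∧
    ∀ x ∈ M, {ℓ : ℕ | ∃ s ∈ AddFactorizations M x, Multiset.card s = ℓ}.Finite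

/-- `M` is a length-finite factorization monoid. -/
def IsLFFM (M : Set ℝ) : Prop :=
  IsAddAtomic M ∧
    ∀ x ∈ M, ∀ ℓ : ℕ, {s ∈ AddFactorizations M x | Multiset.card s = ℓ}.Finite

/-- The sum of the reciprocals of the entries of a multiset of natural numbers. -/
noncomputable def recipSum (K : Type*) [DivisionRing K] (s : Multiset ℕ) : K :=
  (s.map fun p : ℕ => 1 / (p : K)).sum

theorem recipSum_add {K : Type*} [DivisionRing K] (s t : Multiset ℕ) :
    recipSum K (s + t) = recipSum K s + recipSum K t := by
  simp [recipSum]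

theorem recipSum_cons {K : Type*} [DivisionRing K] (p : ℕ) (s : Multiset ℕ) :
    recipSum K (p ::ₘ s) = 1 / (p : K) + recipSum K s := by
  simp [recipSum]

theorem recipSum_replicate {p : ℕ} (hp : p ≠ 0) :
    recipSum ℝ (Multiset.replicate p p) = 1 := by
  have : (p : ℝ) ≠ 0 := by exact_mod_cast hp
  simp [recipSum, this]

theorem cast_recipSum {K : Type*} [DivisionRing K] [CharZero K] (s : Multiset ℕ) :
    ((recipSum ℚ s : ℚ) : K) = recipSum K s := by
  induction s using Multiset.induction_on with
  | empty => simp [recipSum]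
  | cons p s ih => rw [recipSum_cons, recipSum_cons, Rat.cast_add, ih]; simp

theorem recipSum_nonneg (s : Multiset ℕ) : 0 ≤ recipSum ℝ s := by
  refine Multiset.sum_nonneg fun x hx => ?_
  obtain ⟨p, -, rfl⟩ := Multiset.mem_map.1 hx
  positivity

theorem eq_zero_of_recipSum_eq_zero {s : Multiset ℕ} (hs : ∀ p ∈ s, p.Prime)
    (h : recipSum ℝ s = 0) : s = 0 := by
  refine Multiset.eq_zero_of_forall_notMem fun p hp => ?_
  obtain ⟨t, rfl⟩ := Multiset.exists_cons_of_mem hp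
  rw [recipSum_cons] at h
  have h1 := recipSum_nonneg t
  have h2 : 0 < 1 / (p : ℝ) := one_div_pos.2 (by exact_mod_cast (hs p hp).pos)
  linarith

theorem eq_of_le_of_recipSum_eq {s t : Multiset ℕ} (ht : ∀ p ∈ t, p.Prime) (hst : s ≤ t)
    (h : recipSum ℝ s = recipSum ℝ t) : t = s := by
  obtain ⟨u, rfl⟩ := Multiset.le_iff_exists_add.1 hst
  rw [recipSum_add] at h
  have := eq_zero_of_recipSum_eq_zero (s := u)
    (fun p hp => ht p (Multiset.mem_add.2 (Or.inr hp))) (by linarith)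
  simp [this]

theorem padic_norm_recipSum_sub_le_one {p : ℕ} [Fact p.Prime] {s : Multiset ℕ}
    (hs : ∀ q ∈ s, q.Prime) :
    ‖recipSum ℚ_[p] s - (s.count p : ℚ_[p]) / p‖ ≤ 1 := by
  induction s using Multiset.induction_on with
  | empty => simp [recipSum]
  | cons q s ih =>
    have ih := ih fun r hr => hs r (Multiset.mem_cons_of_mem hr)
    have hq := hs q (Multiset.mem_cons_self q s)
    rw [recipSum_cons]
    by_cases h : p = q
    · subst h
      rw [Multiset.count_cons_self]
      convert ih using 2
      push_cast
      ring
    · rw [Multiset.count_cons_of_ne h, add_sub_assoc]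
      refine (Padic.nonarchimedean _ _).trans (max_le ?_ ih)
      have : ‖(q : ℚ_[p])‖ = 1 := by
        rw [Padic.norm_natCast_eq_one_iff]
        exact (Nat.coprime_primes Fact.out hq).2 h
      simp [this]

theorem count_modEq_of_recipSum_eq {s t : Multiset ℕ} (hs : ∀ q ∈ s, q.Prime)
    (ht : ∀ q ∈ t, q.Prime) (h : recipSum ℝ s = recipSum ℝ t) {p : ℕ} (hp : p.Prime) :
    s.count p ≡ t.count p [MOD p] := by
  have : Fact p.Prime := ⟨hp⟩
  have hQ : recipSum ℚ s = recipSum ℚ t := by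
    rw [← cast_recipSum s, ← cast_recipSum t] at h
    exact Rat.cast_injective h
  have hP : recipSum ℚ_[p] s = recipSum ℚ_[p] t := by
    rw [← cast_recipSum s, ← cast_recipSum t, hQ]
  have h1 := padic_norm_recipSum_sub_le_one (p := p) hs
  have h2 := padic_norm_recipSum_sub_le_one (p := p) ht
  rw [hP] at h1
  have h3 : ‖(((t.count p : ℤ) - (s.count p : ℤ) : ℤ) : ℚ_[p]) / p‖ ≤ 1 := by
    have hsub := (Padic.nonarchimedean _ _).trans (max_le h1 ((norm_neg _).trans_le h2))
    rw [show (((t.count p : ℤ) - (s.count p : ℤ) : ℤ) : ℚ_[p]) / p =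
      recipSum ℚ_[p] t - (s.count p : ℚ_[p]) / p
        + -(recipSum ℚ_[p] t - (t.count p : ℚ_[p]) / p) by push_cast; ring]
    exact hsub
  rw [← Int.natCast_modEq_iff, Int.modEq_iff_dvd]
  have hp0 : (0 : ℝ) < p := by exact_mod_cast hp.pos
  have h4 := (Padic.norm_int_le_pow_iff_dvd (p := p) ((t.count p : ℤ) - (s.count p : ℤ)) 1).1 (by
    rw [norm_div, Padic.norm_p, div_inv_eq_mul] at h3
    rw [Nat.cast_one, zpow_neg_one, ← one_div, le_div_iff₀ hp0]
    exact h3)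
  simpa using h4

theorem exists_map_eq_of_forall_reciprocal {s : Multiset ℝ}
    (hs : ∀ a ∈ s, ∃ p : ℕ, p.Prime ∧ a = 1 / (p : ℝ)) :
    ∃ t : Multiset ℕ, (∀ p ∈ t, p.Prime) ∧ t.map (fun p : ℕ => 1 / (p : ℝ)) = s := by
  induction s using Multiset.induction_on with
  | empty => exact ⟨0, by simp, by simp⟩
  | cons a s ih =>
    obtain ⟨t, ht, rfl⟩ := ih fun b hb => hs b (Multiset.mem_cons_of_mem hb)
    obtain ⟨p, hp, rfl⟩ := hs a (Multiset.mem_cons_self a _)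
    refine ⟨p ::ₘ t, fun q hq => ?_, by simp⟩
    rcases Multiset.mem_cons.1 hq with rfl | hq
    · exact hp
    · exact ht q hq

/-- The positive monoid generated by the reciprocals of the primes. -/
abbrev reciprocalPrimesMonoid : AddSubmonoid ℝ :=
  AddSubmonoid.closure {x : ℝ | ∃ p : ℕ, p.Prime ∧ x = 1 / (p : ℝ)}

theorem mem_reciprocalPrimesMonoid_iff {x : ℝ} :
    x ∈ reciprocalPrimesMonoid ↔
      ∃ t : Multiset ℕ, (∀ p ∈ t, p.Prime) ∧ recipSum ℝ t = x := by
  constructor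
  · intro hx
    obtain ⟨s, hs, rfl⟩ := AddSubmonoid.exists_multiset_of_mem_closure hx
    obtain ⟨t, ht, rfl⟩ := exists_map_eq_of_forall_reciprocal hs
    exact ⟨t, ht, rfl⟩
  · rintro ⟨t, ht, rfl⟩
    refine AddSubmonoid.multiset_sum_mem _ _ fun a ha => ?_
    obtain ⟨p, hp, rfl⟩ := Multiset.mem_map.1 ha
    exact AddSubmonoid.subset_closure ⟨p, ht p hp, rfl⟩

theorem isAddAtom_reciprocalPrimesMonoid_iff {a : ℝ} :
    IsAddAtom (reciprocalPrimesMonoid : Set ℝ) a ↔ ∃ p : ℕ, p.Prime ∧ a = 1 / (p : ℝ) := by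
  constructor
  · rintro ⟨ha, ha0, hab⟩
    obtain ⟨t, ht, rfl⟩ := mem_reciprocalPrimesMonoid_iff.1 ha
    obtain ⟨p, hp⟩ := Multiset.exists_mem_of_ne_zero (s := t)
      (by rintro rfl; simp [recipSum] at ha0)
    obtain ⟨u, rfl⟩ := Multiset.exists_cons_of_mem hp
    have hpp := ht p hp
    refine ⟨p, hpp, ?_⟩
    have hpM : 1 / (p : ℝ) ∈ reciprocalPrimesMonoid :=
      AddSubmonoid.subset_closure ⟨p, hpp, rfl⟩
    have huM : recipSum ℝ u ∈ reciprocalPrimesMonoid :=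
      mem_reciprocalPrimesMonoid_iff.2 ⟨u, fun q hq => ht q (Multiset.mem_cons_of_mem hq), rfl⟩
    rcases hab _ hpM _ huM (recipSum_cons p u) with h | h
    · have : (p : ℝ) ≠ 0 := by exact_mod_cast hpp.ne_zero
      simp [this] at h
    · rw [recipSum_cons, h, add_zero]
  · rintro ⟨p, hp, rfl⟩
    have hp0 : (p : ℝ) ≠ 0 := by exact_mod_cast hp.ne_zero
    refine ⟨AddSubmonoid.subset_closure ⟨p, hp, rfl⟩, by simp [hp0], ?_⟩
    intro b hb c hc hbc
    obtain ⟨s, hs, rfl⟩ := mem_reciprocalPrimesMonoid_iff.1 hb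
    obtain ⟨t, ht, rfl⟩ := mem_reciprocalPrimesMonoid_iff.1 hc
    have hst : ∀ q ∈ s + t, q.Prime := fun q hq =>
      (Multiset.mem_add.1 hq).elim (hs q) (ht q)
    have hsum : recipSum ℝ {p} = recipSum ℝ (s + t) := by
      rw [recipSum_add, ← hbc]
      simp [recipSum]
    have hmem : p ∈ s + t := by
      by_contra hnot
      have := count_modEq_of_recipSum_eq (by simpa using hp) hst hsum hp
      rw [Multiset.count_singleton_self, Multiset.count_eq_zero_of_notMem hnot,
        Nat.modEq_zero_iff_dvd] at this
      exact hp.one_lt.ne' (Nat.dvd_one.1 this)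
    have heq := eq_of_le_of_recipSum_eq hst (Multiset.singleton_le.2 hmem) hsum
    have hcard := congrArg Multiset.card heq
    rw [Multiset.card_add, Multiset.card_singleton] at hcard
    have h0 : Multiset.card s = 0 ∨ Multiset.card t = 0 := by omega
    rcases h0 with h | h <;> simp [Multiset.card_eq_zero.1 h, recipSum]

theorem mem_addFactorizations_reciprocalPrimesMonoid_iff {x : ℝ} {s : Multiset ℝ} :
    s ∈ AddFactorizations (reciprocalPrimesMonoid : Set ℝ) x ↔
      ∃ t : Multiset ℕ, (∀ p ∈ t, p.Prime) ∧ recipSum ℝ t = x ∧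
        s = t.map fun p : ℕ => 1 / (p : ℝ) := by
  constructor
  · rintro ⟨hs, rfl⟩
    obtain ⟨t, ht, rfl⟩ := exists_map_eq_of_forall_reciprocal
      fun a ha => isAddAtom_reciprocalPrimesMonoid_iff.1 (hs a ha)
    exact ⟨t, ht, rfl, rfl⟩
  · rintro ⟨t, ht, rfl, rfl⟩
    refine ⟨fun a ha => ?_, rfl⟩
    obtain ⟨p, hp, rfl⟩ := Multiset.mem_map.1 ha
    exact isAddAtom_reciprocalPrimesMonoid_iff.2 ⟨p, ht p hp, rfl⟩

theorem exists_eq_replicate_of_recipSum_eq_one {t : Multiset ℕ} (ht : ∀ p ∈ t, p.Prime)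
    (h : recipSum ℝ t = 1) : ∃ p : ℕ, p.Prime ∧ t = Multiset.replicate p p := by
  obtain ⟨p, hp⟩ := Multiset.exists_mem_of_ne_zero (s := t)
    (by rintro rfl; simp [recipSum] at h)
  have hpp := ht p hp
  have hrep := recipSum_replicate hpp.ne_zero
  have hmod := count_modEq_of_recipSum_eq ht
    (fun q hq => by rwa [Multiset.eq_of_mem_replicate hq]) (h.trans hrep.symm) hpp
  rw [Multiset.count_replicate_self] at hmod
  have hdvd : p ∣ t.count p := (Nat.modEq_zero_iff_dvd).1 (hmod.trans (by simp [Nat.ModEq]))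
  have hle := Nat.le_of_dvd (Multiset.count_pos.2 hp) hdvd
  exact ⟨p, hpp,
    eq_of_le_of_recipSum_eq ht (Multiset.le_count_iff_replicate_le.1 hle) (hrep.trans h.symm)⟩

theorem finite_setOf_recipSum_eq_card_eq (x : ℝ) (l : ℕ) :
    {t : Multiset ℕ | (∀ p ∈ t, p.Prime) ∧ recipSum ℝ t = x ∧ Multiset.card t = l}.Finite := by
  rcases Set.eq_empty_or_nonempty
    {t : Multiset ℕ | (∀ p ∈ t, p.Prime) ∧ recipSum ℝ t = x ∧ Multiset.card t = l} with h | h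
  · simp [h]
  obtain ⟨u, hu, hux, hul⟩ := h
  refine (Set.finite_Icc 0 (l • (u.toFinset ∪ Finset.range (l + 1)).val)).subset ?_
  rintro t ⟨ht, htx, htl⟩
  refine ⟨Multiset.zero_le t, Multiset.le_iff_count.2 fun p => ?_⟩
  by_cases hpt : p ∈ t
  · have hmem : p ∈ u.toFinset ∪ Finset.range (l + 1) := by
      by_contra hnot
      simp only [Finset.mem_union, Multiset.mem_toFinset, Finset.mem_range, not_or] at hnot
      have hmod := count_modEq_of_recipSum_eq ht hu (htx.trans hux.symm) (ht p hpt)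
      rw [Multiset.count_eq_zero_of_notMem hnot.1, Nat.modEq_zero_iff_dvd] at hmod
      have h1 := Nat.le_of_dvd (Multiset.count_pos.2 hpt) hmod
      have h2 := Multiset.count_le_card p t
      omega
    rw [Multiset.count_nsmul, Multiset.count_eq_one_of_mem (Finset.nodup _) hmem, mul_one, ← htl]
    exact Multiset.count_le_card p t
  · simp [Multiset.count_eq_zero_of_notMem hpt]

theorem isLFFM_reciprocalPrimesMonoid : IsLFFM (reciprocalPrimesMonoid : Set ℝ) := by
  refine ⟨fun x hx _ => ?_, fun x _ l => ?_⟩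
  · obtain ⟨t, ht, htx⟩ := mem_reciprocalPrimesMonoid_iff.1 hx
    exact ⟨_, mem_addFactorizations_reciprocalPrimesMonoid_iff.2 ⟨t, ht, htx, rfl⟩⟩
  · refine ((finite_setOf_recipSum_eq_card_eq x l).image
      (Multiset.map fun p : ℕ => 1 / (p : ℝ))).subset ?_
    rintro s ⟨hs, hl⟩
    obtain ⟨t, ht, htx, rfl⟩ := mem_addFactorizations_reciprocalPrimesMonoid_iff.1 hs
    exact ⟨t, ⟨ht, htx, by simpa using hl⟩, rfl⟩

theorem addFactorizations_one_reciprocalPrimesMonoid :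
    AddFactorizations (reciprocalPrimesMonoid : Set ℝ) 1 =
      {s : Multiset ℝ | ∃ p : ℕ, p.Prime ∧ s = Multiset.replicate p (1 / (p : ℝ))} := by
  ext s
  rw [mem_addFactorizations_reciprocalPrimesMonoid_iff]
  constructor
  · rintro ⟨t, ht, h1, rfl⟩
    obtain ⟨p, hp, rfl⟩ := exists_eq_replicate_of_recipSum_eq_one ht h1
    exact ⟨p, hp, Multiset.map_replicate _ _ _⟩
  · rintro ⟨p, hp, rfl⟩
    exact ⟨Multiset.replicate p p, fun q hq => by rwa [Multiset.eq_of_mem_replicate hq],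
      recipSum_replicate hp.ne_zero, by rw [Multiset.map_replicate]⟩

theorem lengths_one_reciprocalPrimesMonoid :
    {l : ℕ | ∃ s ∈ AddFactorizations (reciprocalPrimesMonoid : Set ℝ) 1, Multiset.card s = l} =
      {p : ℕ | p.Prime} := by
  rw [addFactorizations_one_reciprocalPrimesMonoid]
  ext l
  constructor
  · rintro ⟨_, ⟨p, hp, rfl⟩, rfl⟩
    simpa using hp
  · intro hl
    exact ⟨_, ⟨l, hl, rfl⟩, Multiset.card_replicate _ _⟩

theorem not_isBFM_reciprocalPrimesMonoid : ¬ IsBFM (reciprocalPrimesMonoid : Set ℝ) := by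
  intro h
  have h1 : (1 : ℝ) ∈ reciprocalPrimesMonoid :=
    mem_reciprocalPrimesMonoid_iff.2 ⟨Multiset.replicate 2 2,
      fun q hq => by rw [Multiset.eq_of_mem_replicate hq]; exact Nat.prime_two,
      recipSum_replicate two_ne_zero⟩
  have := h.2 1 h1
  rw [lengths_one_reciprocalPrimesMonoid] at this
  exact Nat.infinite_setOfPred_prime this

/-- The positive monoid `M = ⟨1/p : p prime⟩` is an LFFM but not a BFM: its atoms
are exactly the `1/p`, the factorizations of `1` are precisely the multisets
consisting of `p` copies of `1/p` for a prime `p`, and hence the set of lengths of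
factorizations of `1` is the set of all primes. -/
theorem reciprocal_primes_monoid_isLFFM_not_isBFM
    (M : AddSubmonoid ℝ)
    (hgen : M = AddSubmonoid.closure {x : ℝ | ∃ p : ℕ, p.Prime ∧ x = 1 / (p : ℝ)}) :
    IsLFFM (M : Set ℝ) ∧
    ¬ IsBFM (M : Set ℝ) ∧
    {x : ℝ | IsAddAtom (M : Set ℝ) x} = {x : ℝ | ∃ p : ℕ, p.Prime ∧ x = 1 / (p : ℝ)} ∧
    AddFactorizations (M : Set ℝ) 1 =
      {s : Multiset ℝ | ∃ p : ℕ, p.Prime ∧ s = Multiset.replicate p (1 / (p : ℝ))} ∧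
    {ℓ : ℕ | ∃ s ∈ AddFactorizations (M : Set ℝ) 1, Multiset.card s = ℓ} =
      {p : ℕ | p.Prime} := by
  subst hgen
  exact ⟨isLFFM_reciprocalPrimesMonoid, not_isBFM_reciprocalPrimesMonoid,
    Set.ext fun _ => isAddAtom_reciprocalPrimesMonoid_iff,
    addFactorizations_one_reciprocalPrimesMonoid, lengths_one_reciprocalPrimesMonoid⟩
end

section
/- Let M be the positive monoid {0} ∪ ℚ_{≥1}, and let E(M) be the additive submonoid of ℝ generated by {e^m : m ∈ M} (a subsemiring of ℝ). Then the multiplicative monoid of nonzero elements of E(M) is a bounded factorization monoid but not a length-finite factorization monoid; that is, E(M) is a BFS but not an LFFS. -/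
/-- `a` is a multiplicative atom of the set `S ⊆ ℝ` (whose only unit is `1`). -/
def IsMulAtom (S : Set ℝ) (a : ℝ) : Prop :=
  a ∈ S ∧ a ≠ 0 ∧ a ≠ 1 ∧ ∀ b ∈ S, ∀ c ∈ S, a = b * c → b = 1 ∨ c = 1

/-- The multiplicative factorizations of `q` in `S`: multisets of multiplicative
atoms of `S` whose product is `q`. -/
def MulFactorizations (S : Set ℝ) (q : ℝ) : Set (Multiset ℝ) :=
  {s | (∀ a ∈ s, IsMulAtom S a) ∧ s.prod = q}

/-- `S` is a bounded factorization semiring: its multiplicative monoid of nonzero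
elements is atomic and each nonzero element has a finite set of factorization
lengths. -/
def IsBFS (S : Set ℝ) : Prop :=
  (∀ q ∈ S, q ≠ 0 → (MulFactorizations S q).Nonempty) ∧
    ∀ q ∈ S, q ≠ 0 → {ℓ : ℕ | ∃ s ∈ MulFactorizations S q, Multiset.card s = ℓ}.Finite

/-- `S` is a length-finite factorization semiring: its multiplicative monoid of
nonzero elements is atomic and each nonzero element has finitely many
factorizations of each fixed length. -/
def IsLFFS (S : Set ℝ) : Prop :=
  (∀ q ∈ S, q ≠ 0 → (MulFactorizations S q).Nonempty) ∧
    ∀ q ∈ S, q ≠ 0 → ∀ ℓ : ℕ,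
      {s ∈ MulFactorizations S q | Multiset.card s = ℓ}.Finite

/-- The product of two elements of `S ⊆ {0, 1} ∪ [2, ∞)` different from `0` and `1` is at
least `4`, so smaller elements are atoms. -/
lemma isMulAtom_of_lt_four {S : Set ℝ} (hS : ∀ x ∈ S, x = 0 ∨ x = 1 ∨ 2 ≤ x) {a : ℝ}
    (ha : a ∈ S) (h0 : a ≠ 0) (h1 : a ≠ 1) (h4 : a < 4) : IsMulAtom S a := by
  refine ⟨ha, h0, h1, fun b hb c hc h => ?_⟩
  rcases hS b hb with rfl | rfl | hb2
  · simp [h] at h0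
  · exact Or.inl rfl
  · rcases hS c hc with rfl | rfl | hc2
    · simp [h] at h0
    · exact Or.inr rfl
    · nlinarith

lemma IsMulAtom.two_le {S : Set ℝ} (hS : ∀ x ∈ S, x = 0 ∨ x = 1 ∨ 2 ≤ x) {a : ℝ}
    (ha : IsMulAtom S a) : 2 ≤ a := by
  rcases hS a ha.1 with h | h | h
  · exact absurd h ha.2.1
  · exact absurd h ha.2.2.1
  · exact h

lemma mulFactorizations_nonempty_of_lt_two_pow {S : Set ℝ}
    (hS : ∀ x ∈ S, x = 0 ∨ x = 1 ∨ 2 ≤ x) (n : ℕ) :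
    ∀ q ∈ S, q ≠ 0 → q < 2 ^ n → (MulFactorizations S q).Nonempty := by
  induction n with
  | zero =>
    intro q hq h0 hlt
    rcases hS q hq with h | h | h
    · exact absurd h h0
    · norm_num [h] at hlt
    · norm_num at hlt; linarith
  | succ n ih =>
    intro q hq h0 hlt
    by_cases h1 : q = 1
    · exact ⟨0, by simp [MulFactorizations, h1]⟩
    by_cases hA : IsMulAtom S q
    · exact ⟨{q}, by simpa [MulFactorizations] using hA⟩
    obtain ⟨b, hb, c, hc, rfl, hb1, hc1⟩ :
        ∃ b ∈ S, ∃ c ∈ S, q = b * c ∧ b ≠ 1 ∧ c ≠ 1 := by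
      by_contra! h
      exact hA ⟨hq, h0, h1, fun b hb c hc hbc => or_iff_not_imp_left.2 (h b hb c hc hbc)⟩
    have hb0 : b ≠ 0 := left_ne_zero_of_mul h0
    have hc0 : c ≠ 0 := right_ne_zero_of_mul h0
    have hb2 : 2 ≤ b := ((hS b hb).resolve_left hb0).resolve_left hb1
    have hc2 : 2 ≤ c := ((hS c hc).resolve_left hc0).resolve_left hc1
    rw [pow_succ] at hlt
    obtain ⟨s, hs, rfl⟩ := ih b hb hb0 (by nlinarith)
    obtain ⟨t, ht, rfl⟩ := ih c hc hc0 (by nlinarith)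
    refine ⟨s + t, fun a ha => ?_, Multiset.prod_add s t⟩
    exact (Multiset.mem_add.1 ha).elim (hs a) (ht a)

lemma two_pow_card_le_prod {s : Multiset ℝ} (hs : ∀ a ∈ s, 2 ≤ a) :
    2 ^ Multiset.card s ≤ s.prod := by
  induction s using Multiset.induction with
  | empty => simp
  | cons a s ih =>
    rw [Multiset.card_cons, Multiset.prod_cons, pow_succ']
    have ha := hs a (Multiset.mem_cons_self a s)
    have := ih fun b hb => hs b (Multiset.mem_cons_of_mem hb)
    gcongr

lemma isBFS_of_eq_zero_or_eq_one_or_two_le {S : Set ℝ}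
    (hS : ∀ x ∈ S, x = 0 ∨ x = 1 ∨ 2 ≤ x) : IsBFS S := by
  refine ⟨fun q hq h0 => ?_, fun q _ _ => ?_⟩
  · obtain ⟨n, hn⟩ := pow_unbounded_of_one_lt q (one_lt_two : (1 : ℝ) < 2)
    exact mulFactorizations_nonempty_of_lt_two_pow hS n q hq h0 hn
  · obtain ⟨n, hn⟩ := pow_unbounded_of_one_lt q (one_lt_two : (1 : ℝ) < 2)
    refine (Set.finite_Iio n).subset ?_
    rintro _ ⟨s, ⟨hs, rfl⟩, rfl⟩
    have h := two_pow_card_le_prod fun a ha => (hs a ha).two_le hS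
    exact (pow_lt_pow_iff_right₀ (one_lt_two : (1 : ℝ) < 2)).1 (h.trans_lt hn)

lemma eq_zero_or_eq_one_or_two_le_of_mem_closure {M : Set ℝ} (hM : ∀ m ∈ M, m = 0 ∨ 1 ≤ m) :
    ∀ x ∈ AddSubmonoid.closure (Real.exp '' M), x = 0 ∨ x = 1 ∨ 2 ≤ x := by
  intro x hx
  induction hx using AddSubmonoid.closure_induction with
  | mem x hx =>
    obtain ⟨m, hm, rfl⟩ := hx
    rcases hM m hm with rfl | h
    · simp
    · exact Or.inr (Or.inr (by linarith [Real.add_one_le_exp m]))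
  | zero => exact Or.inl rfl
  | add x y _ _ hx hy =>
    rcases hx with rfl | hx
    · simpa using hy
    rcases hy with rfl | hy
    · simpa using Or.inr hx
    have hx1 : 1 ≤ x := hx.elim Eq.ge one_le_two.trans
    have hy1 : 1 ≤ y := hy.elim Eq.ge one_le_two.trans
    exact Or.inr (Or.inr (by linarith))

lemma exp_five_quarters_lt_four : Real.exp (5 / 4) < 4 := by
  have h : Real.exp (5 / 4) ^ 4 = Real.exp 1 ^ 5 := by
    rw [← Real.exp_nat_mul, ← Real.exp_nat_mul]
    norm_num
  refine lt_of_pow_lt_pow_left₀ 4 (by norm_num) ?_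
  rw [h]
  calc Real.exp 1 ^ 5 < 3 ^ 5 :=
        pow_lt_pow_left₀ (Real.exp_one_lt_d9.trans (by norm_num)) (Real.exp_pos 1).le (by norm_num)
    _ < 4 ^ 4 := by norm_num

/-- If every `exp m` with `m ∈ [1, 5/4]` rational is an atom of `S`, then `exp (9/4)` has
infinitely many factorizations of length two. -/
lemma infinite_mulFactorizations_exp {S : Set ℝ}
    (hS : ∀ t : ℚ, (1 : ℝ) ≤ t → (t : ℝ) ≤ 5 / 4 → IsMulAtom S (Real.exp t)) :
    {s ∈ MulFactorizations S (Real.exp (9 / 4)) | Multiset.card s = 2}.Infinite := by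
  have hpos (n : ℕ) : (0 : ℝ) < 1 / (n + 9) := by positivity
  have hlt (n : ℕ) : (1 : ℝ) / (n + 9) < 1 / 8 := by
    gcongr
    linarith [n.cast_nonneg (α := ℝ)]
  let f : ℕ → Multiset ℝ := fun n =>
    {Real.exp (1 + 1 / (n + 9)), Real.exp (5 / 4 - 1 / (n + 9))}
  refine Set.infinite_of_injective_forall_mem (f := f) ?_ ?_
  · intro m n h
    have hm : Real.exp (1 + 1 / (m + 9)) ∈ f n := h ▸ by simp [f]
    simp only [f, Multiset.insert_eq_cons, Multiset.mem_cons, Multiset.mem_singleton,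
      Real.exp_eq_exp] at hm
    rcases hm with hm | hm
    · have h9 := add_left_cancel hm
      rw [one_div, one_div, inv_inj] at h9
      exact_mod_cast add_right_cancel h9
    · linarith [hlt m, hlt n]
  · intro n
    refine ⟨⟨fun a ha => ?_, ?_⟩, by simp [f]⟩
    · simp only [f, Multiset.insert_eq_cons, Multiset.mem_cons, Multiset.mem_singleton] at ha
      rcases ha with rfl | rfl
      · have := hS (1 + 1 / (n + 9))
        push_cast at this
        exact this (by linarith [hpos n]) (by linarith [hlt n])
      · have := hS (5 / 4 - 1 / (n + 9))
        push_cast at this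
        exact this (by linarith [hlt n]) (by linarith [hpos n])
    · simp only [f, Multiset.insert_eq_cons, Multiset.prod_cons, Multiset.prod_singleton,
        ← Real.exp_add]
      congr 1
      ring

/-- For the positive monoid `M = {0} ∪ ℚ_{≥1}`, the exponentiation semiring `E(M)`
is a BFS but not an LFFS. -/
theorem exponentiation_of_zero_union_rat_ge_one_isBFS_not_isLFFS :
    IsBFS (AddSubmonoid.closure
      (Real.exp '' {x : ℝ | x = 0 ∨ ((∃ t : ℚ, x = (t : ℝ)) ∧ 1 ≤ x)}) : Set ℝ) ∧
    ¬ IsLFFS (AddSubmonoid.closure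
      (Real.exp '' {x : ℝ | x = 0 ∨ ((∃ t : ℚ, x = (t : ℝ)) ∧ 1 ≤ x)}) : Set ℝ) := by
  have hS := eq_zero_or_eq_one_or_two_le_of_mem_closure
    (M := {x : ℝ | x = 0 ∨ ((∃ t : ℚ, x = (t : ℝ)) ∧ 1 ≤ x)}) fun m hm => hm.imp_right And.right
  have hmem (t : ℚ) (ht : (1 : ℝ) ≤ t) :
      Real.exp t ∈ AddSubmonoid.closure
        (Real.exp '' {x : ℝ | x = 0 ∨ ((∃ t : ℚ, x = (t : ℝ)) ∧ 1 ≤ x)}) :=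
    AddSubmonoid.subset_closure (Set.mem_image_of_mem _ (Or.inr ⟨⟨t, rfl⟩, ht⟩))
  refine ⟨isBFS_of_eq_zero_or_eq_one_or_two_le hS, fun h => ?_⟩
  have hq := hmem (9 / 4) (by norm_num)
  push_cast at hq
  refine infinite_mulFactorizations_exp (fun t h1 h5 => ?_) (h.2 _ hq (Real.exp_ne_zero _) 2)
  refine isMulAtom_of_lt_four hS (hmem t h1) (Real.exp_ne_zero _) ?_
    ((Real.exp_le_exp.2 h5).trans_lt exp_five_quarters_lt_four)
  exact (Real.one_lt_exp_iff.2 (by linarith)).ne'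
end

section
/- Consider the positive semiring S₁ := ℕ₀ ∪ ℝ_{≥1} (nonnegative integers together with all real numbers at least 1), which is closed under addition and multiplication. Then the multiplicative monoid of nonzero elements of S₁ is antimatter: it has no atoms, i.e., every s ∈ S₁ with s > 1 can be written as s = bc with b, c ∈ S₁ and b, c ≠ 1 (for instance s = (s·n/(n+1))·((n+1)/n) for n large enough). -/
theorem one_lt_sqrt_of_one_lt {x : ℝ} (hx : 1 < x) : 1 < √x :=
  Real.lt_sqrt_of_sq_lt (by simpa using hx)

/-- The positive semiring `S₁ = ℕ₀ ∪ ℝ_{≥1}` is multiplicatively antimatter: it has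
no multiplicative atoms, and every `s ∈ S₁` with `s > 1` factors as `s = b * c` with
`b, c ∈ S₁` both different from `1`. -/
theorem S_one_is_antimatter :
    (¬ ∃ a : ℝ, IsMulAtom {x : ℝ | (∃ n : ℕ, x = (n : ℝ)) ∨ 1 ≤ x} a) ∧
    ∀ s ∈ {x : ℝ | (∃ n : ℕ, x = (n : ℝ)) ∨ 1 ≤ x}, 1 < s →
      ∃ b ∈ {x : ℝ | (∃ n : ℕ, x = (n : ℝ)) ∨ 1 ≤ x},
        ∃ c ∈ {x : ℝ | (∃ n : ℕ, x = (n : ℝ)) ∨ 1 ≤ x},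
          b ≠ 1 ∧ c ≠ 1 ∧ s = b * c := by
  refine ⟨?_, fun s _ hs ↦ ?_⟩
  · rintro ⟨a, ha, ha0, ha1, hfac⟩
    have hle : 1 ≤ a := by
      rcases ha with ⟨n, rfl⟩ | ha
      · exact_mod_cast Nat.one_le_iff_ne_zero.mpr (by exact_mod_cast ha0)
      · exact ha
    have hsqrt := one_lt_sqrt_of_one_lt (lt_of_le_of_ne hle ha1.symm)
    have h := hfac √a (Or.inr hsqrt.le) √a (Or.inr hsqrt.le)
      (Real.mul_self_sqrt (zero_le_one.trans hle)).symm
    exact hsqrt.ne' (h.elim id id)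
  · have hsqrt := one_lt_sqrt_of_one_lt hs
    exact ⟨√s, Or.inr hsqrt.le, √s, Or.inr hsqrt.le, hsqrt.ne', hsqrt.ne',
      (Real.mul_self_sqrt (zero_le_one.trans hs.le)).symm⟩
end
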